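/- Let N ∈ ℕ, W ∈ (0,1), and let (s_l)_{l=0}^{2N} be an orthonormal basis of ℝ^{2N+1} (indexed over {−N,…,N}) consisting of eigenvectors of the matrix K[n,m] = W·sinc(W(n−m)), with eigenvalues (λ_l)_{l=0}^{2N}. Let r : ℤ → ℂ satisfy r[n] = 0 for n ∉ {−N,…,N}, with expansion coefficients a_l := Σ_{n=−N}^{N} r[n]·s_l[n], and define b[n] := Σ_{q=−N}^{N} r[q]·sinc(W(n−q)) for n ∈ ℤ. Then the tail energy of the band-limited extension satisfies Σ_{n ≤ −N−1} |b[n]|² + Σ_{n ≥ N+1} |b[n]|² = Σ_{l=0}^{2N} |a_l / W|² · λ_l (1 − λ_l). -/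

import Mathlib

open scoped BigOperators

/-- normalized sinc: sinc(x) = sin(πx)/(πx) for x ≠ 0, sinc(0) = 1. -/
noncomputable def sinc (x : ℝ) : ℝ :=
  if x = 0 then 1 else Real.sin (Real.pi * x) / (Real.pi * x)

theorem sinc_neg (x : ℝ) : sinc (-x) = sinc x := by
  simp [sinc, neg_div_neg_eq]

/-- The Fourier coefficients of the indicator function of `[-W/2, W/2]`. -/
theorem integral_exp_eq_sinc (W : ℝ) (k : ℤ) :
    ∫ x in (-(W / 2))..(W / 2), Complex.exp (2 * Real.pi * Complex.I * k * x)
      = ((W * sinc (W * k) : ℝ) : ℂ) := by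
  rcases eq_or_ne k 0 with rfl | hk
  · simp [sinc]
  rcases eq_or_ne W 0 with rfl | hW
  · simp
  have hk' : (k : ℂ) ≠ 0 := by exact_mod_cast hk
  have hW' : (W : ℂ) ≠ 0 := by exact_mod_cast hW
  have hpi : (Real.pi : ℂ) ≠ 0 := by exact_mod_cast Real.pi_ne_zero
  have hI := Complex.I_ne_zero
  have hWk : W * (k : ℝ) ≠ 0 := mul_ne_zero hW (by exact_mod_cast hk)
  have hc : 2 * (Real.pi : ℂ) * Complex.I * k ≠ 0 :=
    mul_ne_zero (mul_ne_zero (mul_ne_zero two_ne_zero hpi) hI) hk'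
  rw [integral_exp_mul_complex hc, sinc, if_neg hWk]
  push_cast
  rw [Complex.sin]
  have h₁ : 2 * (Real.pi : ℂ) * Complex.I * k * (W / 2) = Real.pi * (W * k) * Complex.I := by ring
  have h₂ : 2 * (Real.pi : ℂ) * Complex.I * k * (-(W / 2))
      = -(Real.pi * (W * k)) * Complex.I := by ring
  rw [h₁, h₂]
  field_simp
  rw [Complex.I_sq]
  ring

theorem integral_trigPoly_mul_exp (I : Finset ℤ) (W : ℝ) (r : ℤ → ℂ) (n : ℤ) :
    ∫ x in (-(W / 2))..(W / 2), Complex.exp (2 * Real.pi * Complex.I * ((-n : ℤ) : ℂ) * x)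
        * ∑ q ∈ I, r q * Complex.exp (2 * Real.pi * Complex.I * q * x)
      = W * ∑ q ∈ I, r q * (sinc (W * ((n : ℝ) - (q : ℝ))) : ℂ) := by
  have h : ∀ x : ℝ, Complex.exp (2 * Real.pi * Complex.I * ((-n : ℤ) : ℂ) * x)
      * ∑ q ∈ I, r q * Complex.exp (2 * Real.pi * Complex.I * q * x)
      = ∑ q ∈ I, r q * Complex.exp (2 * Real.pi * Complex.I * ((q - n : ℤ) : ℂ) * x) := by
    intro x
    rw [Finset.mul_sum]
    refine Finset.sum_congr rfl fun q _ => ?_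
    rw [mul_left_comm, ← Complex.exp_add]
    push_cast
    ring_nf
  simp_rw [h]
  rw [intervalIntegral.integral_finsetSum
    fun q _ => (by fun_prop : Continuous _).intervalIntegrable _ _, Finset.mul_sum]
  refine Finset.sum_congr rfl fun q _ => ?_
  rw [intervalIntegral.integral_const_mul, integral_exp_eq_sinc,
    ← sinc_neg (W * ((n : ℝ) - (q : ℝ)))]
  push_cast
  rw [show -(W * ((n : ℝ) - (q : ℝ))) = W * ((q : ℝ) - n) by ring]
  ring

theorem integral_norm_sq_trigPoly (I : Finset ℤ) (W : ℝ) (r : ℤ → ℂ) :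
    ((∫ x in (-(W / 2))..(W / 2),
        ‖∑ q ∈ I, r q * Complex.exp (2 * Real.pi * Complex.I * q * x)‖ ^ 2 : ℝ) : ℂ)
      = ∑ n ∈ I, (W * ∑ q ∈ I, r q * (sinc (W * ((n : ℝ) - (q : ℝ))) : ℂ))
          * starRingEnd ℂ (r n) := by
  have h : ∀ x : ℝ,
      ((‖∑ q ∈ I, r q * Complex.exp (2 * Real.pi * Complex.I * q * x)‖ ^ 2 : ℝ) : ℂ)
      = ∑ n ∈ I, starRingEnd ℂ (r n)
        * (Complex.exp (2 * Real.pi * Complex.I * ((-n : ℤ) : ℂ) * x)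
          * ∑ q ∈ I, r q * Complex.exp (2 * Real.pi * Complex.I * q * x)) := by
    intro x
    push_cast
    rw [← Complex.conj_mul', map_sum, Finset.sum_mul]
    refine Finset.sum_congr rfl fun n _ => ?_
    rw [map_mul, ← Complex.exp_conj, ← mul_assoc]
    simp only [map_mul, Complex.conj_I, Complex.conj_ofReal, map_ofNat, map_intCast]
    ring_nf
  rw [← intervalIntegral.integral_ofReal]
  simp_rw [h]
  rw [intervalIntegral.integral_finsetSum
    fun q _ => (by fun_prop : Continuous _).intervalIntegrable _ _]
  refine Finset.sum_congr rfl fun n _ => ?_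
  rw [intervalIntegral.integral_const_mul, integral_trigPoly_mul_exp, mul_comm]

theorem intervalIntegral_indicator_Ioc {E : Type*} [NormedAddCommGroup E] [NormedSpace ℝ E]
    {a b c d : ℝ} (hab : a ≤ b) (hbc : b ≤ c) (hcd : c ≤ d) (f : ℝ → E) :
    ∫ x in a..d, (Set.Ioc b c).indicator f x = ∫ x in b..c, f x := by
  rw [intervalIntegral.integral_of_le (hab.trans (hbc.trans hcd)),
    intervalIntegral.integral_of_le hbc, MeasureTheory.setIntegral_indicator measurableSet_Ioc,
    Set.inter_eq_right.mpr (Set.Ioc_subset_Ioc hab hcd)]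

/-- Parseval's identity for a trigonometric polynomial cut off to `[-W/2, W/2]`. -/
theorem hasSum_norm_sq_sinc_sum (I : Finset ℤ) {W : ℝ} (hW : W ∈ Set.Ioo (0 : ℝ) 1)
    (r : ℤ → ℂ) :
    HasSum (fun n : ℤ => ‖W * ∑ q ∈ I, r q * (sinc (W * ((n : ℝ) - (q : ℝ))) : ℂ)‖ ^ 2)
      (∫ x in (-(W / 2))..(W / 2),
        ‖∑ q ∈ I, r q * Complex.exp (2 * Real.pi * Complex.I * q * x)‖ ^ 2) := by
  obtain ⟨h0, h1⟩ := hW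
  set R : ℝ → ℂ := fun x => ∑ q ∈ I, r q * Complex.exp (2 * Real.pi * Complex.I * q * x) with hR
  have hRc : Continuous R := by fun_prop
  have hlt : (-(1 / 2) : ℝ) < 1 / 2 := by norm_num
  set S := Set.Ioc (-(W / 2)) (W / 2)
  have hL2 : MeasureTheory.MemLp (S.indicator R) 2
      (MeasureTheory.volume.restrict (Set.Ioc (-(1 / 2) : ℝ) (1 / 2))) := by
    refine MeasureTheory.MemLp.indicator measurableSet_Ioc ?_
    obtain ⟨C, hC⟩ := isCompact_Icc.exists_bound_of_continuousOn (hRc.continuousOn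
      (s := Set.Icc (-(1 / 2) : ℝ) (1 / 2)))
    exact MeasureTheory.MemLp.of_bound hRc.aestronglyMeasurable C
      ((MeasureTheory.ae_restrict_iff' measurableSet_Ioc).mpr
        (Filter.Eventually.of_forall fun x hx => hC x (Set.Ioc_subset_Icc_self hx)))
  have key := hasSum_sq_fourierCoeffOn hlt hL2
  have hcoef : ∀ n : ℤ, fourierCoeffOn hlt (S.indicator R) n
      = W * ∑ q ∈ I, r q * (sinc (W * ((n : ℝ) - (q : ℝ))) : ℂ) := by
    intro n
    rw [fourierCoeffOn_eq_integral, ← integral_trigPoly_mul_exp,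
      ← intervalIntegral_indicator_Ioc (a := -(1 / 2)) (b := -(W / 2)) (c := W / 2)
        (d := 1 / 2) (by linarith) (by linarith) (by linarith)]
    have : (1 / (1 / 2 - -(1 / 2)) : ℝ) = 1 := by norm_num
    rw [this, one_smul]
    refine intervalIntegral.integral_congr fun x _ => ?_
    simp only [Set.indicator_apply, smul_eq_mul, fourier_coe_apply, S]
    split_ifs
    · norm_num [hR]
    · simp
  simp_rw [hcoef] at key
  convert key using 1
  rw [← intervalIntegral_indicator_Ioc (a := -(1 / 2)) (b := -(W / 2)) (c := W / 2)
        (d := 1 / 2) (by linarith) (by linarith) (by linarith)]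
  have : ((1 / 2 - -(1 / 2))⁻¹ : ℝ) = 1 := by norm_num
  rw [this, one_smul]
  refine intervalIntegral.integral_congr fun x _ => ?_
  simp only [Set.indicator_apply, S]
  split_ifs <;> simp [hR]

theorem sum_Icc_neg_eq_sum_range {M : Type*} [AddCommMonoid M] (f : ℤ → M) (N : ℕ) :
    ∑ n ∈ Finset.Icc (-(N : ℤ)) (N : ℤ), f n
      = ∑ k ∈ Finset.range (N + 1), f k + ∑ k ∈ Finset.range N, f (-((k : ℤ) + 1)) := by
  induction N with
  | zero => simp
  | succ N ih =>
    have h : Finset.Icc (-((N + 1 : ℕ) : ℤ)) ((N + 1 : ℕ) : ℤ)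
        = insert (-((N : ℤ) + 1)) (insert ((N : ℤ) + 1) (Finset.Icc (-(N : ℤ)) (N : ℤ))) := by
      ext x
      simp only [Finset.mem_Icc, Finset.mem_insert]
      push_cast
      omega
    rw [h, Finset.sum_insert (by simp; omega), Finset.sum_insert (by simp), ih,
      Finset.sum_range_succ _ (N + 1),
      Finset.sum_range_succ (fun k : ℕ => f (-((k : ℤ) + 1))) N]
    push_cast
    ac_rfl

theorem HasSum.tsum_tails_int {f : ℤ → ℝ} {T : ℝ} (hf : HasSum f T) (N : ℕ) :
    (∑' k : ℕ, f (-(N : ℤ) - 1 - k)) + (∑' k : ℕ, f ((N : ℤ) + 1 + k))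
      = T - ∑ n ∈ Finset.Icc (-(N : ℤ)) (N : ℤ), f n := by
  have h₁ : Summable fun k : ℕ => f k :=
    hf.summable.comp_injective (i := fun k : ℕ => (k : ℤ)) Nat.cast_injective
  have h₂ : Summable fun k : ℕ => f (-((k : ℤ) + 1)) :=
    hf.summable.comp_injective (i := fun k : ℕ => -((k : ℤ) + 1)) fun a b h => by
      simp only at h; omega
  have e₁ := h₁.sum_add_tsum_nat_add (N + 1)
  have e₂ := h₂.sum_add_tsum_nat_add N
  have e₃ := tsum_of_nat_of_neg_add_one h₁ h₂
  have t₁ : ∑' k : ℕ, f ((N : ℤ) + 1 + k) = ∑' k : ℕ, f ((k + (N + 1) : ℕ) : ℤ) :=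
    tsum_congr fun k => congrArg f (by push_cast; ring)
  have t₂ : ∑' k : ℕ, f (-(N : ℤ) - 1 - k) = ∑' k : ℕ, f (-(((k + N : ℕ) : ℤ) + 1)) :=
    tsum_congr fun k => congrArg f (by push_cast; ring)
  rw [hf.tsum_eq] at e₃
  rw [sum_Icc_neg_eq_sum_range, t₁, t₂]
  linarith

/-- Finitely many orthonormal vectors, as many as there are coordinates, form a complete system. -/
theorem sum_mul_eq_ite_of_orthonormal {ι α : Type*} [Fintype ι] [DecidableEq ι] [DecidableEq α]
    (I : Finset α) (hcard : Fintype.card ι = I.card) (s : ι → α → ℝ)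
    (horth : ∀ l l', ∑ n ∈ I, s l n * s l' n = if l = l' then 1 else 0)
    {n m : α} (hn : n ∈ I) (hm : m ∈ I) :
    ∑ l, s l n * s l m = if n = m then 1 else 0 := by
  let A : Matrix ι I ℝ := Matrix.of fun l n => s l n
  have h : A * A.transpose = 1 := by
    ext l l'
    rw [Matrix.mul_apply, Matrix.one_apply, ← horth l l']
    exact Finset.sum_coe_sort I fun n => s l n * s l' n
  rw [Matrix.mul_eq_one_comm_of_card_eq _ _ _ (by simpa using hcard)] at h
  have h' := congrFun (congrFun h ⟨n, hn⟩) ⟨m, hm⟩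
  simpa [Matrix.mul_apply, Matrix.one_apply, A] using h'

/-- Parseval's identity for a finite orthonormal system. -/
theorem sum_mul_conj_of_orthonormal {ι α : Type*} [Fintype ι] [DecidableEq ι]
    (I : Finset α) (s : ι → α → ℝ)
    (horth : ∀ l l', ∑ n ∈ I, s l n * s l' n = if l = l' then 1 else 0) (c d : ι → ℂ) :
    ∑ n ∈ I, (∑ l, c l * (s l n : ℂ)) * starRingEnd ℂ (∑ l, d l * (s l n : ℂ))
      = ∑ l, c l * starRingEnd ℂ (d l) := by
  have horth' : ∀ l l', ∑ n ∈ I, (s l n : ℂ) * (s l' n : ℂ) = if l = l' then 1 else 0 := by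
    intro l l'
    have := congrArg (fun x : ℝ => (x : ℂ)) (horth l l')
    split_ifs at this ⊢ <;> exact_mod_cast this
  calc _ = ∑ n ∈ I, ∑ l, ∑ l', c l * starRingEnd ℂ (d l') * ((s l n : ℂ) * (s l' n : ℂ)) := by
        refine Finset.sum_congr rfl fun n _ => ?_
        rw [map_sum, Finset.sum_mul_sum]
        refine Finset.sum_congr rfl fun l _ => Finset.sum_congr rfl fun l' _ => ?_
        rw [map_mul, Complex.conj_ofReal]
        ring
    _ = ∑ l, ∑ l', c l * starRingEnd ℂ (d l') * ∑ n ∈ I, (s l n : ℂ) * (s l' n : ℂ) := by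
        rw [Finset.sum_comm]
        refine Finset.sum_congr rfl fun l _ => ?_
        rw [Finset.sum_comm]
        simp_rw [Finset.mul_sum]
    _ = _ := by simp [horth']

/-- the tail energy of the band-limited extension of an index-limited sequence
expanded in an orthonormal DPSS eigenbasis equals `Σ_l |a_l/W|²·λ_l(1−λ_l)`. -/
theorem tailEnergy_bandlimited_expansion
    (N : ℕ) (W : ℝ) (hW : W ∈ Set.Ioo (0 : ℝ) 1)
    (s : Fin (2*N+1) → ℤ → ℝ) (lam : Fin (2*N+1) → ℝ)
    (horth : ∀ l l' : Fin (2*N+1),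
      ∑ n ∈ Finset.Icc (-(N : ℤ)) (N : ℤ), s l n * s l' n = if l = l' then 1 else 0)
    (heig : ∀ l : Fin (2*N+1), ∀ n ∈ Finset.Icc (-(N : ℤ)) (N : ℤ),
      ∑ m ∈ Finset.Icc (-(N : ℤ)) (N : ℤ), W * sinc (W * ((n : ℝ) - (m : ℝ))) * s l m
        = lam l * s l n)
    (r : ℤ → ℂ) (hr : ∀ n : ℤ, n ∉ Finset.Icc (-(N : ℤ)) (N : ℤ) → r n = 0)
    (b : ℤ → ℂ)
    (hb : ∀ n : ℤ, b n = ∑ q ∈ Finset.Icc (-(N : ℤ)) (N : ℤ),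
      r q * (sinc (W * ((n : ℝ) - (q : ℝ))) : ℂ)) :
    (∑' k : ℕ, ‖b (-(N : ℤ) - 1 - (k : ℤ))‖ ^ 2) + (∑' k : ℕ, ‖b ((N : ℤ) + 1 + (k : ℤ))‖ ^ 2)
      = ∑ l : Fin (2*N+1),
          ‖(∑ n ∈ Finset.Icc (-(N : ℤ)) (N : ℤ), r n * ((s l n : ℝ) : ℂ)) / (W : ℂ)‖ ^ 2
            * (lam l * (1 - lam l)) := by
  set I := Finset.Icc (-(N : ℤ)) (N : ℤ)
  set a : Fin (2*N+1) → ℂ := fun l => ∑ n ∈ I, r n * ((s l n : ℝ) : ℂ) with ha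
  have hrep : ∀ n ∈ I, r n = ∑ l, a l * (s l n : ℂ) := by
    intro n hn
    have hcomp : ∀ m ∈ I, ∑ l, (s l m : ℂ) * (s l n : ℂ) = if m = n then 1 else 0 := by
      intro m hm
      have hcard : Fintype.card (Fin (2 * N + 1)) = I.card := by
        simp only [Fintype.card_fin, I, Int.card_Icc]
        omega
      have := congrArg (fun x : ℝ => (x : ℂ)) (sum_mul_eq_ite_of_orthonormal I hcard s horth hm hn)
      split_ifs at this ⊢ <;> exact_mod_cast this
    simp_rw [ha, Finset.sum_mul, mul_assoc]
    rw [Finset.sum_comm]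
    simp_rw [← Finset.mul_sum]
    rw [Finset.sum_congr rfl fun m hm => by rw [hcomp m hm]]
    simp [hn]
  have hWb : ∀ n ∈ I, W * b n = ∑ l, (lam l * a l) * (s l n : ℂ) := by
    intro n hn
    have heig' : ∀ l, ∑ m ∈ I, (W : ℂ) * (sinc (W * ((n : ℝ) - (m : ℝ))) : ℂ) * (s l m : ℂ)
        = lam l * s l n := by
      intro l
      have := congrArg (fun x : ℝ => (x : ℂ)) (heig l n hn)
      push_cast at this
      exact this
    calc (W : ℂ) * b n
        = ∑ q ∈ I, ∑ l, a l * (W * (sinc (W * ((n : ℝ) - (q : ℝ))) : ℂ) * (s l q : ℂ)) := by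
          rw [hb, Finset.mul_sum]
          refine Finset.sum_congr rfl fun q hq => ?_
          rw [hrep q hq, Finset.sum_mul, Finset.mul_sum]
          exact Finset.sum_congr rfl fun l _ => by ring
      _ = ∑ l, a l * (lam l * s l n) := by
          rw [Finset.sum_comm]
          simp_rw [← Finset.mul_sum, heig']
      _ = _ := Finset.sum_congr rfl fun l _ => by ring
  have hsum := hasSum_norm_sq_sinc_sum I hW r
  simp_rw [← hb] at hsum
  have htotal : (∫ x in (-(W / 2))..(W / 2),
      ‖∑ q ∈ I, r q * Complex.exp (2 * Real.pi * Complex.I * q * x)‖ ^ 2)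
      = ∑ l, lam l * ‖a l‖ ^ 2 := by
    have h := integral_norm_sq_trigPoly I W r
    simp_rw [← hb] at h
    rw [Finset.sum_congr rfl fun n hn => by rw [hWb n hn, hrep n hn],
      sum_mul_conj_of_orthonormal I s horth] at h
    refine Complex.ofReal_injective (h.trans ?_)
    simp [mul_assoc, Complex.mul_conj']
  have hinner : ∑ n ∈ I, ‖W * b n‖ ^ 2 = ∑ l, lam l ^ 2 * ‖a l‖ ^ 2 := by
    have h : ∑ n ∈ I, (W * b n) * starRingEnd ℂ (W * b n)
        = ∑ l, (lam l * a l) * starRingEnd ℂ (lam l * a l) := by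
      rw [Finset.sum_congr rfl fun n hn => by rw [hWb n hn]]
      exact sum_mul_conj_of_orthonormal I s horth _ _
    simp_rw [Complex.mul_conj'] at h
    have h' : ∑ n ∈ I, ‖W * b n‖ ^ 2 = ∑ l, ‖lam l * a l‖ ^ 2 := by exact_mod_cast h
    simpa [mul_pow] using h'
  have htail := hsum.tsum_tails_int N
  rw [htotal, hinner, ← Finset.sum_sub_distrib] at htail
  simp_rw [norm_mul, mul_pow, tsum_mul_left] at htail
  rw [← mul_add] at htail
  have hW2 : ‖(W : ℂ)‖ ^ 2 ≠ 0 := by simpa using hW.1.ne'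
  rw [eq_div_of_mul_eq hW2 ((mul_comm _ _).trans htail), Finset.sum_div]
  refine Finset.sum_congr rfl fun l _ => ?_
  rw [norm_div, div_pow]
  ring
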